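/- Let $\tau$ and $\rho$ be primitive aperiodic substitutions with balanced growth and the same dominant eigenvalue $\lambda > 1$, and let $\rho^{-1}$ be a balanced almost inverse of $\rho$. Then there exist constants $D, I \in \mathbb{N}$ (depending only on $\tau$ and $\rho$) such that for every block map $f : X_\tau \to X_\rho$, setting $\Phi_i = \rho^{-i} \circ f \circ \tau^i$, we have $Z(\Phi_i) = 1$ and $D(\Phi_i) \le D$ for all $i$, and $I(\Phi_i) \le I$ for all sufficiently large $i$. -/

import Mathlib

open Filter Topology

section Defs

variable {A : Type*} {B : Type*} {C : Type*}

/-- The one-sided shift map. -/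
def shift (x : ℕ → A) : ℕ → A := fun n => x (n + 1)

/-- A (one-sided) subshift: a closed, shift-invariant set of configurations. -/
def Subshift [TopologicalSpace A] (X : Set (ℕ → A)) : Prop :=
  IsClosed X ∧ ∀ x ∈ X, shift x ∈ X

/-- `X` is uniformly recurrent: every pattern occurring in `X` occurs in every
sufficiently long window of every point of `X`. -/
def UniformlyRecurrent (X : Set (ℕ → A)) : Prop :=
  ∀ x ∈ X, ∀ l : ℕ, ∃ N : ℕ, ∀ y ∈ X, ∃ i < N, ∀ k < l, y (i + k) = x k

/-- A block map: a continuous shift-commuting map. -/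
def BlockMap [TopologicalSpace A] [TopologicalSpace B] (X : Set (ℕ → A)) (Y : Set (ℕ → B))
    (f : (ℕ → A) → (ℕ → B)) : Prop :=
  Set.MapsTo f X Y ∧ ContinuousOn f X ∧ ∀ x ∈ X, f (shift x) = shift (f x)

/-- `s` is a cocycle for `Φ` on `X`: `Φ (σ x) = σ^(s x) (Φ x)`. -/
def IsCocycle (X : Set (ℕ → A)) (Φ : (ℕ → A) → (ℕ → B)) (s : (ℕ → A) → ℕ) : Prop :=
  ∀ x ∈ X, ∀ n : ℕ, Φ (shift x) n = Φ x (n + s x)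

/-- A dill map: a continuous map with a continuous cocycle which is nontrivial
along every orbit. -/
def DillMap [TopologicalSpace A] [TopologicalSpace B] (X : Set (ℕ → A)) (Y : Set (ℕ → B))
    (Φ : (ℕ → A) → (ℕ → B)) : Prop :=
  Set.MapsTo Φ X Y ∧ ContinuousOn Φ X ∧
    ∃ s : (ℕ → A) → ℕ, ContinuousOn s X ∧ IsCocycle X Φ s ∧
      ∀ x ∈ X, ∃ n : ℕ, 0 < s (shift^[n] x)

/-- Continuity (local constancy) of a word-valued function on `X`. -/
def WordContinuousOn (φ : (ℕ → A) → List B) (X : Set (ℕ → A)) : Prop :=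
  ∀ x ∈ X, ∃ R : ℕ, ∀ y ∈ X, (∀ k ≤ R, y k = x k) → φ y = φ x

/-- `φ` is an implementation of `Φ` on `X`:
`Φ x = φ x ++ φ (σ x) ++ φ (σ² x) ++ ⋯`, expressed coordinatewise. -/
def IsImplementation (X : Set (ℕ → A)) (Φ : (ℕ → A) → (ℕ → B))
    (φ : (ℕ → A) → List B) : Prop :=
  WordContinuousOn φ X ∧ ∀ x ∈ X, ∀ n : ℕ,
    Φ x n = if h : n < (φ x).length then (φ x).get ⟨n, h⟩
            else Φ (shift x) (n - (φ x).length)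

/-- `ⁿφ(x) = φ(x) φ(σ x) ⋯ φ(σ^(n-1) x)`. -/
def iterWord (φ : (ℕ → A) → List B) (x : ℕ → A) : ℕ → List B
  | 0 => []
  | n + 1 => iterWord φ x n ++ φ (shift^[n] x)

/-- The invariant `Z`: `|ⁿφ(x)|/n → lam` for every `x ∈ X`. -/
def HasZ (X : Set (ℕ → A)) (φ : (ℕ → A) → List B) (lam : ℝ) : Prop :=
  ∀ x ∈ X, Tendsto (fun n : ℕ => ((iterWord φ x n).length : ℝ) / n) atTop (𝓝 lam)

/-- `D` is a deviation bound: `| |ⁿφ(x)| - lam·n | ≤ D` for all `x ∈ X`, `n`. -/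
def HasDBound (X : Set (ℕ → A)) (φ : (ℕ → A) → List B) (lam D : ℝ) : Prop :=
  ∀ x ∈ X, ∀ n : ℕ, |((iterWord φ x n).length : ℝ) - lam * n| ≤ D

/-- `R` is an in-radius bound for `φ` on `X`: `φ x` only depends on `x_[0,R]`. -/
def HasInRadius (X : Set (ℕ → A)) (φ : (ℕ → A) → List B) (R : ℕ) : Prop :=
  ∀ x ∈ X, ∀ y ∈ X, (∀ k ≤ R, x k = y k) → φ x = φ y

/-- Almost equivalence: images of every point agree up to shifts. -/
def AlmostEquiv (X : Set (ℕ → A)) (Φ Ψ : (ℕ → A) → (ℕ → B)) : Prop :=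
  ∀ x ∈ X, ∃ i j : ℕ, shift^[i] (Φ x) = shift^[j] (Ψ x)

/-- The implementation of the composition of two dill maps. -/
def compImpl (φ₁ : (ℕ → A) → List B) (Φ₁ : (ℕ → A) → (ℕ → B))
    (φ₂ : (ℕ → B) → List C) (x : ℕ → A) : List C :=
  iterWord φ₂ (Φ₁ x) (φ₁ x).length

/-- Extension of a substitution to words. -/
def wordApply (τ : A → List A) (w : List A) : List A := (w.map τ).flatten

/-- Iterated image `τⁿ(a)` of a letter. -/
def subPow (τ : A → List A) : ℕ → A → List A
  | 0, a => [a]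
  | n + 1, a => wordApply τ (subPow τ n a)

/-- The language of the substitution `τ`: infixes of the `τⁿ(a)`. -/
def InLanguage (τ : A → List A) (w : List A) : Prop :=
  ∃ a n, w <:+: subPow τ n a

/-- The one-sided subshift of the substitution `τ`. -/
def Xsub (τ : A → List A) : Set (ℕ → A) :=
  {x | ∀ i l : ℕ, InLanguage τ (List.ofFn fun k : Fin l => x (i + k))}

/-- Primitivity of a substitution. -/
def Primitive (τ : A → List A) : Prop :=
  ∃ N, ∀ n ≥ N, ∀ a b : A, a ∈ subPow τ n b

/-- The word `w` occurs in `x` at position `i`. -/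
def occursAt (w : List A) (x : ℕ → A) (i : ℕ) : Prop :=
  w = List.ofFn fun k : Fin w.length => x (i + k)

/-- The action of a (non-erasing) substitution on one-sided configurations. -/
def subApply [Inhabited A] (τ : A → List A) (x : ℕ → A) : ℕ → A :=
  fun n => (wordApply τ (List.ofFn fun k : Fin (n + 1) => x k)).getD n default

end Defs


/-! ### Basic tools -/

/-- Birkhoff sums of a length function. -/
def bsum {A : Type*} (l : (ℕ → A) → ℕ) (x : ℕ → A) (n : ℕ) : ℕ :=
  ∑ j ∈ Finset.range n, l (shift^[j] x)

/-- Cocycle of an iterate. -/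
def itc {A : Type*} (l : (ℕ → A) → ℕ) (F : (ℕ → A) → (ℕ → A)) (x : ℕ → A) (n : ℕ) : ℕ → ℕ
  | 0 => n
  | k + 1 => bsum l (F^[k] x) (itc l F x n k)

/-- agreement on a prefix -/
def agree {A : Type*} (n : ℕ) (x y : ℕ → A) : Prop := ∀ k < n, x k = y k

theorem shift_iter {A : Type*} (n : ℕ) (x : ℕ → A) (k : ℕ) : (shift^[n] x) k = x (k + n) := by
  induction n generalizing x with
  | zero => rfl
  | succ n ih =>
    rw [Function.iterate_succ_apply, ih]
    simp only [shift]
    congr 1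

theorem shift_iter_mem {A : Type*} {X : Set (ℕ → A)} (hX : ∀ x ∈ X, shift x ∈ X) {x : ℕ → A}
    (hx : x ∈ X) (n : ℕ) : shift^[n] x ∈ X := by
  induction n with
  | zero => exact hx
  | succ n ih => rw [Function.iterate_succ_apply']; exact hX _ ih

theorem iterWord_length {A B : Type*} (φ : (ℕ → A) → List B) (x : ℕ → A) (n : ℕ) :
    (iterWord φ x n).length = bsum (fun x => (φ x).length) x n := by
  induction n with
  | zero => rfl
  | succ n ih => simp [iterWord, ih, bsum, Finset.sum_range_succ]

theorem bsum_succ' {A : Type*} (l : (ℕ → A) → ℕ) (x : ℕ → A) (n : ℕ) :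
    bsum l x (n + 1) = l x + bsum l (shift x) n := by
  simp [bsum, Finset.sum_range_succ', add_comm]

theorem impl_cocycle {A B : Type*} {X : Set (ℕ → A)} {Φ : (ℕ → A) → (ℕ → B)}
    {φ : (ℕ → A) → List B} (h : IsImplementation X Φ φ) :
    ∀ x ∈ X, Φ (shift x) = shift^[(φ x).length] (Φ x) := by
  intro x hx
  funext n
  rw [shift_iter, h.2 x hx (n + (φ x).length), dif_neg (by omega)]
  simp

theorem cocycle_iter {A B : Type*} {X : Set (ℕ → A)} (hX : ∀ x ∈ X, shift x ∈ X)
    {Φ : (ℕ → A) → (ℕ → B)} {l : (ℕ → A) → ℕ}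
    (h : ∀ x ∈ X, Φ (shift x) = shift^[l x] (Φ x)) (n : ℕ) (x : ℕ → A) (hx : x ∈ X) :
    Φ (shift^[n] x) = shift^[bsum l x n] (Φ x) := by
  induction n generalizing x with
  | zero => rfl
  | succ n ih =>
    rw [Function.iterate_succ_apply, ih _ (hX _ hx), h x hx, bsum_succ',
      ← Function.iterate_add_apply, add_comm]

theorem itc_spec {A : Type*} {X : Set (ℕ → A)} (hX : ∀ x ∈ X, shift x ∈ X)
    {F : (ℕ → A) → (ℕ → A)} (hF : Set.MapsTo F X X) {l : (ℕ → A) → ℕ}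
    (h : ∀ x ∈ X, F (shift x) = shift^[l x] (F x)) (n k : ℕ) (x : ℕ → A) (hx : x ∈ X) :
    F^[k] (shift^[n] x) = shift^[itc l F x n k] (F^[k] x) := by
  induction k with
  | zero => rfl
  | succ k ih =>
    rw [Function.iterate_succ_apply', ih, cocycle_iter hX h _ _ (hF.iterate k hx),
      Function.iterate_succ_apply']
    rfl

theorem itc_bound {A : Type*} {X : Set (ℕ → A)}
    {F : (ℕ → A) → (ℕ → A)} (hF : Set.MapsTo F X X) {l : (ℕ → A) → ℕ} {c D : ℝ} (hc : 0 ≤ c)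
    (h : ∀ x ∈ X, ∀ n : ℕ, |(bsum l x n : ℝ) - c * n| ≤ D) (n k : ℕ) (x : ℕ → A) (hx : x ∈ X) :
    |(itc l F x n k : ℝ) - c ^ k * n| ≤ D * ∑ j ∈ Finset.range k, c ^ j := by
  induction k with
  | zero => simp [itc]
  | succ k ih =>
    have h1 := h _ (hF.iterate k hx) (itc l F x n k)
    have h2 : |c * ((itc l F x n k : ℝ) - c ^ k * n)| ≤
        c * (D * ∑ j ∈ Finset.range k, c ^ j) := by
      rw [abs_mul, abs_of_nonneg hc]
      exact mul_le_mul_of_nonneg_left ih hc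
    have h3 : ∑ j ∈ Finset.range (k+1), c ^ j = c * ∑ j ∈ Finset.range k, c ^ j + 1 := by
      rw [Finset.sum_range_succ', Finset.mul_sum]
      simp [pow_succ, mul_comm]
    rw [h3]
    simp only [itc]
    rw [abs_le] at *
    constructor <;> [have := h1.1; have := h1.2] <;> [have := h2.1; have := h2.2] <;>
    · ring_nf at *
      linarith

theorem step_agree {A B : Type*} {X : Set (ℕ → A)} (hX : ∀ x ∈ X, shift x ∈ X)
    {Φ : (ℕ → A) → (ℕ → B)}
    {φ : (ℕ → A) → List B} (h : IsImplementation X Φ φ) {R : ℕ} (hR : HasInRadius X φ R)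
    (m : ℕ) (x y : ℕ → A) (hx : x ∈ X) (hy : y ∈ X) (ha : agree (m + R) x y) :
    bsum (fun x => (φ x).length) x m = bsum (fun x => (φ x).length) y m ∧
    agree (bsum (fun x => (φ x).length) x m) (Φ x) (Φ y) := by
  induction m generalizing x y with
  | zero => exact ⟨rfl, fun k hk => by simp [bsum] at hk⟩
  | succ m ih =>
    have e : φ x = φ y := hR x hx y hy fun k hk => ha k (by omega)
    have ⟨h1, h2⟩ := ih (shift x) (shift y) (hX _ hx) (hX _ hy)
      (fun k hk => ha (k+1) (by omega))
    rw [bsum_succ', bsum_succ']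
    refine ⟨by rw [e, h1], fun k hk => ?_⟩
    rw [h.2 x hx, h.2 y hy]
    simp only [e]
    split_ifs with hlt
    · simp only [List.get_eq_getElem, e]
    · rw [e] at hk
      exact h2 _ (by omega)

theorem aper_inj {A : Type*} {X : Set (ℕ → A)} (hX : ∀ x ∈ X, shift x ∈ X)
    (hap : ∀ y ∈ X, ∀ p : ℕ, 0 < p → shift^[p] y ≠ y) {y : ℕ → A} (hy : y ∈ X) {a b : ℕ}
    (h : shift^[a] y = shift^[b] y) : a = b := by
  by_contra hne
  wlog hlt : a < b generalizing a b
  · exact this h.symm (Ne.symm hne) (by omega)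
  apply hap (shift^[a] y) (shift_iter_mem hX hy a) (b - a) (by omega)
  rw [← Function.iterate_add_apply, h]
  congr 2
  omega

/-! ### Compactness -/

theorem cont_agree {A B : Type*} [TopologicalSpace A] [DiscreteTopology A] [TopologicalSpace B]
    [DiscreteTopology B] {X : Set (ℕ → A)} {g : (ℕ → A) → B} (hg : ContinuousOn g X)
    (x : ℕ → A) (hx : x ∈ X) : ∃ R : ℕ, ∀ y ∈ X, (∀ k ≤ R, y k = x k) → g y = g x := by
  have h1 : g ⁻¹' {g x} ∈ 𝓝[X] x := hg x hx (by simp)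
  rw [mem_nhdsWithin] at h1
  obtain ⟨U, hU, hxU, hsub⟩ := h1
  rw [isOpen_pi_iff] at hU
  obtain ⟨s, u, hu, hs⟩ := hU x hxU
  refine ⟨s.sup id, fun y hy hk => hsub ⟨hs ?_, hy⟩⟩
  intro k hks
  rw [hk k (Finset.le_sup (f := id) hks)]
  exact (hu k hks).2

theorem unif_radius {A B : Type*} [Fintype A] [TopologicalSpace A] [DiscreteTopology A]
    {X : Set (ℕ → A)} (hc : IsClosed X) {φ : (ℕ → A) → List B} (h : WordContinuousOn φ X) :
    ∃ R, HasInRadius X φ R := by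
  choose! R hR using h
  have hK : IsCompact X := hc.isCompact
  obtain ⟨t, ht, hcov⟩ := hK.elim_nhds_subcover
    (fun x => {y | ∀ k ≤ R x, y k = x k}) (by
      intro x hx
      apply IsOpen.mem_nhds
      · have : {y : ℕ → A | ∀ k ≤ R x, y k = x k} =
            ⋂ k ∈ Finset.range (R x + 1), (fun y : ℕ → A => y k) ⁻¹' {x k} := by
          ext y; simp [Nat.lt_succ_iff]
        rw [this]
        apply isOpen_biInter_finset
        intro k _
        exact (isOpen_discrete _).preimage (continuous_apply k)
      · intro k _; rfl)
  refine ⟨t.sup R, fun x hx y hy hxy => ?_⟩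
  obtain ⟨z, hz, hxz⟩ := Set.mem_iUnion₂.1 (hcov hx)
  have hle : R z ≤ t.sup R := Finset.le_sup hz
  rw [hR z (ht z hz) x hx hxz, hR z (ht z hz) y hy]
  intro k hk
  rw [← hxy k (hk.trans hle)]
  exact hxz k hk

theorem Xsub_shift {A : Type*} (τ : A → List A) : ∀ x ∈ Xsub τ, shift x ∈ Xsub τ := by
  intro x hx i l
  have := hx (i+1) l
  convert this using 4 with k
  simp only [shift]
  congr 1
  omega

theorem Xsub_closed {A : Type*} [TopologicalSpace A] [DiscreteTopology A]
    (τ : A → List A) : IsClosed (Xsub τ) := by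
  have : Xsub τ = ⋂ i : ℕ, ⋂ l : ℕ, (fun (x : ℕ → A) (k : Fin l) => x (i + k)) ⁻¹'
      {v | InLanguage τ (List.ofFn v)} := by
    ext x; simp [Xsub]
  rw [this]
  refine isClosed_iInter fun i => isClosed_iInter fun l => ?_
  refine (isClosed_discrete _).preimage (continuous_pi fun k => continuous_apply _)

/-! ### Substitutions as dill maps -/

theorem prim_nonerasing {A : Type*} {τ : A → List A} (h : Primitive τ) (a : A) :
    1 ≤ (τ a).length := by
  by_contra hlt
  have h0 : τ a = [] := List.length_eq_zero_iff.1 (by omega)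
  obtain ⟨N, hN⟩ := h
  have : ∀ n, subPow τ (n+1) a = [] := by
    intro n
    induction n with
    | zero => simp [subPow, wordApply, h0]
    | succ n ih => rw [subPow, ih]; rfl
  have h2 := hN (N+1) (by omega) a a
  rw [this] at h2
  simp at h2

theorem wordApply_append {A : Type*} (τ : A → List A) (u v : List A) :
    wordApply τ (u ++ v) = wordApply τ u ++ wordApply τ v := by simp [wordApply]

theorem wordApply_length {A : Type*} {τ : A → List A} (h : ∀ a, 1 ≤ (τ a).length) (u : List A) :
    u.length ≤ (wordApply τ u).length := by
  induction u with
  | nil => simp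
  | cons a u ih =>
    have := h a
    simp [wordApply] at *
    omega

theorem ofFn_add {A : Type*} (x : ℕ → A) (m n : ℕ) :
    (List.ofFn fun k : Fin (m + n) => x k) =
      (List.ofFn fun k : Fin m => x k) ++ List.ofFn fun k : Fin n => x (m + k) := by
  rw [List.ofFn_add]
  simp

theorem subApply_eq {A : Type*} [Inhabited A] {τ : A → List A} (h : ∀ a, 1 ≤ (τ a).length)
    (x : ℕ → A) {n m : ℕ} (hnm : n < m) :
    subApply τ x n = (wordApply τ (List.ofFn fun k : Fin m => x k)).getD n default := by
  obtain ⟨d, rfl⟩ := Nat.exists_eq_add_of_le (show n + 1 ≤ m from hnm)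
  rw [ofFn_add, wordApply_append, List.getD_append]
  · rfl
  · refine lt_of_lt_of_le ?_ (wordApply_length h _)
    simp

theorem subApply_impl {A : Type*} [Inhabited A] {τ : A → List A} (h : ∀ a, 1 ≤ (τ a).length)
    (X : Set (ℕ → A)) : IsImplementation X (subApply τ) (fun x => τ (x 0)) := by
  refine ⟨fun x _ => ⟨0, fun y _ hk => by simp [hk 0 le_rfl]⟩, fun x _ n => ?_⟩
  have e : wordApply τ (List.ofFn fun k : Fin (n+1) => x k) =
      τ (x 0) ++ wordApply τ (List.ofFn fun k : Fin n => shift x k) := by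
    simp [List.ofFn_succ, wordApply, shift]
  have e2 : subApply τ x n = _ := congrArg (fun w => List.getD w n default) e
  rw [e2]
  split_ifs with hlt
  · rw [List.getD_append _ _ _ _ hlt, List.getD_eq_getElem _ _ hlt]
    rfl
  · simp only at hlt ⊢
    rw [List.getD_append_right _ _ _ _ (by omega)]
    have := h (x 0)
    rw [subApply_eq h (shift x) (m := n) (by omega)]

theorem subApply_maps {A : Type*} [Inhabited A] {τ : A → List A} (h : ∀ a, 1 ≤ (τ a).length) :
    Set.MapsTo (subApply τ) (Xsub τ) (Xsub τ) := by
  intro x hx i l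
  obtain ⟨a, n, u, v, huv⟩ := hx 0 (i + l)
  refine ⟨a, n + 1, ?_⟩
  simp only [zero_add] at huv
  rw [subPow, ← huv, wordApply_append, wordApply_append]
  refine List.IsInfix.trans ?_ (List.infix_append _ _ _)
  have hlen := wordApply_length h (List.ofFn fun k : Fin (i + l) => x k)
  rw [List.length_ofFn] at hlen
  have : (List.ofFn fun k : Fin l => subApply τ x (i + k)) =
      ((wordApply τ (List.ofFn fun k : Fin (i + l) => x k)).drop i).take l := by
    apply List.ext_getElem
    · simp; omega
    · intro k h1 h2
      simp at h1
      rw [List.getElem_ofFn, subApply_eq h x (m := i + l) (by simp; omega)]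
      simp only [List.getElem_take, List.getElem_drop]
      rw [List.getD_eq_getElem]
  rw [this]
  exact (List.take_prefix _ _).isInfix.trans (List.drop_suffix _ _).isInfix

theorem subApply_cont {A : Type*} [Inhabited A] [Fintype A] [TopologicalSpace A]
    [DiscreteTopology A] (τ : A → List A) : Continuous (subApply τ) := by
  refine continuous_pi fun n => ?_
  have h1 : Continuous (fun v : Fin (n+1) → A =>
    (wordApply τ (List.ofFn v)).getD n default) := continuous_of_discreteTopology
  have h2 : Continuous (fun (x : ℕ → A) (k : Fin (n+1)) => x k) :=
    continuous_pi fun k => continuous_apply _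
  exact h1.comp h2

theorem shift_cont {A : Type*} [TopologicalSpace A] : Continuous (shift : (ℕ → A) → ℕ → A) :=
  continuous_pi fun n => continuous_apply _

/-! ### Minimal subsets and the product of growth rates -/

theorem exists_minimal_sub {A : Type*} [Fintype A] [TopologicalSpace A] [DiscreteTopology A]
    {X : Set (ℕ → A)} (hc : IsClosed X) (hX : ∀ x ∈ X, shift x ∈ X) (hne : X.Nonempty) :
    ∃ Y ⊆ X, IsClosed Y ∧ (∀ x ∈ Y, shift x ∈ Y) ∧ Y.Nonempty ∧
      ∀ Z ⊆ Y, IsClosed Z → (∀ x ∈ Z, shift x ∈ Z) → Z.Nonempty → Z = Y := by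
  let S : Set (Set (ℕ → A)) := {Y | IsClosed Y ∧ (∀ x ∈ Y, shift x ∈ Y) ∧ Y.Nonempty}
  obtain ⟨m, hmX, hm⟩ := zorn_superset_nonempty S (by
    intro c hcS hchain hcne
    refine ⟨⋂₀ c, ⟨isClosed_sInter fun t ht => (hcS ht).1,
      fun x hx t ht => (hcS ht).2.1 x (hx t ht), ?_⟩, fun s hs => Set.sInter_subset_of_mem hs⟩
    haveI := hcne.to_subtype
    exact IsCompact.nonempty_sInter_of_directed_nonempty_isCompact_isClosed
      (fun a ha b hb => (hchain.total ha hb).elim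
        (fun hab => ⟨a, ha, subset_rfl, hab⟩) (fun hba => ⟨b, hb, hba, subset_rfl⟩)) (fun t ht => (hcS ht).2.2)
      (fun t ht => (hcS ht).1.isCompact) (fun t ht => (hcS ht).1)) X ⟨hc, hX, hne⟩
  refine ⟨m, hmX, hm.prop.1, hm.prop.2.1, hm.prop.2.2, fun Z hZ h1 h2 h3 => ?_⟩
  exact Set.Subset.antisymm hZ (hm.le_of_le ⟨h1, h2, h3⟩ hZ)

theorem rate_prod {A : Type*} [Fintype A] [TopologicalSpace A] [DiscreteTopology A]
    {X : Set (ℕ → A)} (hc : IsClosed X) (hX : ∀ x ∈ X, shift x ∈ X) (hne : X.Nonempty)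
    (hap : ∀ y ∈ X, ∀ p : ℕ, 0 < p → shift^[p] y ≠ y)
    {Ψ : (ℕ → A) → (ℕ → A)} (hΨ : ContinuousOn Ψ X)
    (hae : AlmostEquiv X Ψ id) {s : (ℕ → A) → ℕ → ℕ}
    (hs : ∀ x ∈ X, ∀ n, Ψ (shift^[n] x) = shift^[s x n] (Ψ x)) {c D : ℝ}
    (hD : ∀ x ∈ X, ∀ n, |(s x n : ℝ) - c * n| ≤ D) : c = 1 := by
  obtain ⟨Y, hYX, hYc, hYs, hYne, hmin⟩ := exists_minimal_sub hc hX hne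
  haveI : CompactSpace Y := isCompact_iff_compactSpace.1 hYc.isCompact
  haveI : Nonempty Y := hYne.to_subtype
  have hΨY : Continuous (fun y : Y => Ψ y) := (hΨ.mono hYX).restrict
  let E : ℕ × ℕ → Set Y := fun p => {y | shift^[p.1] (Ψ y) = shift^[p.2] (y : ℕ → A)}
  have hE : ∀ p, IsClosed (E p) := fun p =>
    isClosed_eq ((shift_cont.iterate p.1).comp hΨY)
      ((shift_cont.iterate p.2).comp continuous_subtype_val)
  have hU : ⋃ p, E p = Set.univ := by
    ext y
    simp only [Set.mem_iUnion, Set.mem_univ, iff_true]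
    obtain ⟨i, j, hij⟩ := hae y (hYX y.2)
    exact ⟨(i, j), hij⟩
  obtain ⟨⟨i, j⟩, y0, hy0⟩ := nonempty_interior_of_iUnion_of_closed hE hU
  obtain ⟨U, hUo, hUe⟩ := isOpen_induced_iff.1 (isOpen_interior (s := E (i, j)))
  have hUE : ∀ y ∈ Y, y ∈ U → shift^[i] (Ψ y) = shift^[j] y := by
    intro y hy hyU
    have : (⟨y, hy⟩ : Y) ∈ interior (E (i, j)) := by rw [← hUe]; exact hyU
    have h2 : (⟨y, hy⟩ : Y) ∈ E (i, j) := interior_subset this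
    exact h2
  have hy0U : (y0 : ℕ → A) ∈ U := by rw [← hUe] at hy0; exact hy0
  -- every orbit visits `U`
  have hvis : ∀ y ∈ Y, ∃ n, shift^[n] y ∈ U := by
    by_contra hcon
    push Not at hcon
    obtain ⟨z, hz, hzU⟩ := hcon
    have hZ := hmin (Y ∩ ⋂ n : ℕ, (shift^[n]) ⁻¹' Uᶜ) Set.inter_subset_left
      (hYc.inter (isClosed_iInter fun n => hUo.isClosed_compl.preimage (shift_cont.iterate n)))
      (fun x hx => ⟨hYs x hx.1, Set.mem_iInter.2 fun n => by
        have := Set.mem_iInter.1 hx.2 (n+1)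
        simpa [Function.iterate_succ_apply] using this⟩)
      ⟨z, hz, Set.mem_iInter.2 fun n => hzU n⟩
    have h0 : (y0 : ℕ → A) ∈ Y ∩ ⋂ n : ℕ, (shift^[n]) ⁻¹' Uᶜ := by rw [hZ]; exact y0.2
    exact Set.mem_iInter.1 h0.2 0 hy0U
  have hreturn : ∀ n, ∃ m ≥ n, (s y0 m) = m := by
    intro n
    obtain ⟨k, hk⟩ := hvis _ (shift_iter_mem hYs y0.2 n)
    rw [← Function.iterate_add_apply] at hk
    refine ⟨k + n, by omega, ?_⟩
    have h1 := hUE _ (shift_iter_mem hYs y0.2 _) hk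
    have h2 := hUE _ y0.2 hy0U
    rw [hs _ (hYX y0.2), ← Function.iterate_add_apply, ← Function.iterate_add_apply] at h1
    have h3 : shift^[s y0 (k+n) + j] (y0 : ℕ → A) = shift^[j + (k + n)] y0 := by
      rw [Function.iterate_add_apply, ← h2, ← h1, ← Function.iterate_add_apply, add_comm]
    have := aper_inj hX hap (hYX y0.2) h3
    omega
  by_contra hne1
  have hpos : 0 < |1 - c| := abs_pos.2 (sub_ne_zero.2 (Ne.symm hne1))
  obtain ⟨n, hn⟩ := exists_nat_gt (D / |1 - c|)
  obtain ⟨m, hmn, hsm⟩ := hreturn n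
  have h1 := hD y0 (hYX y0.2) m
  rw [hsm, show (m : ℝ) - c * m = (1 - c) * m by ring, abs_mul, abs_of_nonneg (Nat.cast_nonneg m : (0:ℝ) ≤ m)]
    at h1
  rw [div_lt_iff₀ hpos] at hn
  have : (n : ℝ) ≤ m := by exact_mod_cast hmn
  nlinarith

/-! ### Agreement under iterates -/

theorem geom_bd {c : ℝ} (h0 : 0 ≤ c) (h1 : c < 1) (k : ℕ) :
    ∑ j ∈ Finset.range k, c ^ j ≤ 1 / (1 - c) := by
  rw [le_div_iff₀ (by linarith), mul_comm, mul_neg_geom_sum]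
  have := pow_nonneg h0 k
  linarith

theorem geom_bd' {c : ℝ} (h1 : 1 < c) (k : ℕ) :
    ∑ j ∈ Finset.range k, c ^ j ≤ c ^ k * (1 / (c - 1)) := by
  rw [mul_one_div, le_div_iff₀ (by linarith), geom_sum_mul]
  linarith

theorem itc_agree {A : Type*} {X : Set (ℕ → A)} (hX : ∀ x ∈ X, shift x ∈ X)
    {F : (ℕ → A) → (ℕ → A)} (hF : Set.MapsTo F X X)
    {φ : (ℕ → A) → List A} (h : IsImplementation X F φ) (hR : HasInRadius X φ 0)
    (n k : ℕ) (x y : ℕ → A) (hx : x ∈ X) (hy : y ∈ X) (ha : agree n x y) :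
    itc (fun x => (φ x).length) F x n k = itc (fun x => (φ x).length) F y n k ∧
    agree (itc (fun x => (φ x).length) F x n k) (F^[k] x) (F^[k] y) := by
  induction k with
  | zero => exact ⟨rfl, ha⟩
  | succ k ih =>
    have := step_agree hX h hR _ _ _ (hF.iterate k hx) (hF.iterate k hy) ih.2
    rw [Function.iterate_succ_apply', Function.iterate_succ_apply']
    simp only [itc]
    rw [← ih.1]
    exact this

theorem inv_agree {A : Type*} {X : Set (ℕ → A)} (hX : ∀ x ∈ X, shift x ∈ X)
    {F : (ℕ → A) → (ℕ → A)} (hF : Set.MapsTo F X X)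
    {φ : (ℕ → A) → List A} (h : IsImplementation X F φ) {R : ℕ} (hR : HasInRadius X φ R)
    {c D : ℝ} (hc0 : 0 < c) (hc1 : c < 1) (hD0 : 0 ≤ D)
    (hD : ∀ x ∈ X, ∀ n : ℕ, |(bsum (fun x => (φ x).length) x n : ℝ) - c * n| ≤ D)
    (x y : ℕ → A) (hx : x ∈ X) (hy : y ∈ X) (L₀ t i : ℕ) (ha : agree L₀ x y)
    (hG : (R + D) / (1 - c) + D / (1 - c) + R ≤ c ^ i * ((L₀ : ℝ) - t)) (k : ℕ) (hk : k ≤ i) :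
    itc (fun x => (φ x).length) F x t k = itc (fun x => (φ x).length) F y t k ∧
    ∃ L : ℕ, agree L (F^[k] x) (F^[k] y) ∧
      itc (fun x => (φ x).length) F x t k + R ≤ L ∧
      c ^ k * L₀ - (R + D) / (1 - c) ≤ L := by
  have h1c : 0 < 1 - c := by linarith
  have hC0 : 0 ≤ (R + D) / (1 - c) := by positivity
  have hE0 : 0 ≤ D / (1 - c) := by positivity
  have hdiff : 0 ≤ (L₀ : ℝ) - t := by
    by_contra hneg
    have : c ^ i * ((L₀ : ℝ) - t) < 0 := mul_neg_of_pos_of_neg (by positivity) (by linarith)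
    have : (0:ℝ) ≤ R := by positivity
    linarith
  -- the bound on `t` implies the bound on `L`
  have key : ∀ k ≤ i, ∀ L : ℕ, c ^ k * L₀ - (R + D) / (1 - c) ≤ (L : ℝ) →
      itc (fun x => (φ x).length) F x t k + R ≤ L := by
    intro k hk L hL
    have hb := (abs_le.1 (itc_bound hF hc0.le hD t k x hx)).2
    have hg : D * ∑ j ∈ Finset.range k, c ^ j ≤ D / (1 - c) := by
      rw [← mul_one_div]
      exact mul_le_mul_of_nonneg_left (geom_bd hc0.le hc1 k) hD0
    have hp : c ^ i * ((L₀ : ℝ) - t) ≤ c ^ k * ((L₀ : ℝ) - t) :=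
      mul_le_mul_of_nonneg_right (pow_le_pow_of_le_one hc0.le hc1.le hk) hdiff
    have : ((itc (fun x => (φ x).length) F x t k + R : ℕ) : ℝ) ≤ (L : ℝ) := by
      push_cast
      rw [mul_sub] at hp hG
      linarith
    exact_mod_cast this
  induction k with
  | zero =>
    refine ⟨rfl, L₀, ha, key 0 hk _ ?_, ?_⟩ <;> simpa using hC0
  | succ k ih =>
    obtain ⟨e, L, haL, hLt, hL⟩ := ih (by omega)
    have s1 := step_agree hX h hR (itc (fun x => (φ x).length) F x t k) _ _
      (hF.iterate k hx) (hF.iterate k hy) (fun j hj => haL j (by omega))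
    have s2 := step_agree hX h hR (L - R) _ _
      (hF.iterate k hx) (hF.iterate k hy) (fun j hj => haL j (by omega))
    have hb := (abs_le.1 (hD _ (hF.iterate k hx) (L - R))).1
    rw [Nat.cast_sub (by omega)] at hb
    have hfin : c ^ (k+1) * L₀ - (R + D) / (1 - c) ≤
        (bsum (fun x => (φ x).length) (F^[k] x) (L - R) : ℝ) := by
      have h1 : c * (c ^ k * L₀ - (R + D) / (1 - c)) ≤ c * L := mul_le_mul_of_nonneg_left hL hc0.le
      have h2 : (R + D) / (1 - c) = c * ((R + D) / (1 - c)) + (R + D) := by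
        field_simp
        ring
      have h3 : c * R ≤ R := by
        have : (0:ℝ) ≤ R := by positivity
        nlinarith
      have h4 : c * (c ^ k * L₀ - (R + D) / (1 - c)) =
        c ^ (k+1) * L₀ - c * ((R + D) / (1 - c)) := by ring
      linarith
    refine ⟨?_, _, ?_, key (k+1) hk _ hfin, hfin⟩
    · simp only [itc]
      rw [← e]
      exact s1.1
    · rw [Function.iterate_succ_apply', Function.iterate_succ_apply']
      exact s2.2

theorem block_iter {A B : Type*} {X : Set (ℕ → A)} (hX : ∀ x ∈ X, shift x ∈ X)
    {f : (ℕ → A) → (ℕ → B)} (h : ∀ x ∈ X, f (shift x) = shift (f x)) (n : ℕ) (x : ℕ → A)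
    (hx : x ∈ X) : f (shift^[n] x) = shift^[n] (f x) := by
  induction n generalizing x with
  | zero => rfl
  | succ n ih => rw [Function.iterate_succ_apply, ih _ (hX _ hx), h x hx]; rfl

theorem block_agree {A B : Type*} [Fintype A] [TopologicalSpace A] [DiscreteTopology A]
    [TopologicalSpace B] [DiscreteTopology B] {X : Set (ℕ → A)} {Y : Set (ℕ → B)}
    (hc : IsClosed X) (hX : ∀ x ∈ X, shift x ∈ X)
    {f : (ℕ → A) → (ℕ → B)} (hf : BlockMap X Y f) :
    ∃ r : ℕ, ∀ x ∈ X, ∀ y ∈ X, ∀ n, agree n x y → agree (n - r) (f x) (f y) := by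
  have hcont : ContinuousOn (fun x => f x 0) X := (continuous_apply 0).comp_continuousOn hf.2.1
  obtain ⟨r, hr⟩ := unif_radius (φ := fun x => [f x 0]) hc (by
    intro x hx
    obtain ⟨R, hR⟩ := cont_agree hcont x hx
    exact ⟨R, fun y hy hk => by simp only [hR y hy hk]⟩)
  refine ⟨r, fun x hx y hy n hn j hj => ?_⟩
  have h1 := hr _ (shift_iter_mem hX hx j) _ (shift_iter_mem hX hy j) (fun k hk => by
    rw [shift_iter, shift_iter]
    exact hn _ (by omega))
  simp only [block_iter hX hf.2.2 _ _ hx, block_iter hX hf.2.2 _ _ hy] at h1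
  simpa [shift_iter] using h1

theorem impl_eq {A B : Type*} {X : Set (ℕ → A)} {Φ : (ℕ → A) → (ℕ → B)}
    {φ : (ℕ → A) → List B} (h : IsImplementation X Φ φ) {x y : ℕ → A} (hx : x ∈ X) (hy : y ∈ X)
    (hl : (φ x).length = (φ y).length) (ha : agree (φ x).length (Φ x) (Φ y)) : φ x = φ y := by
  apply List.ext_getElem hl
  intro k h1 h2
  have := ha k h1
  rw [h.2 x hx, h.2 y hy, dif_pos h1, dif_pos h2] at this
  simpa using this

/-- repeated conjugation `Φᵢ = ρ⁻ⁱ ∘ f ∘ τⁱ` of a block map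
between the subshifts of two balanced primitive aperiodic substitutions with
common dominant eigenvalue `lam > 1` keeps `Z = 1` and `D` bounded, and
eventually bounds the in-radius `I`. -/
theorem stmt17 {A B : Type*} [Fintype A] [Fintype B] [Inhabited A] [Inhabited B]
    [TopologicalSpace A] [DiscreteTopology A] [TopologicalSpace B] [DiscreteTopology B]
    (τ : A → List A) (ρ : B → List B)
    (hτprim : Primitive τ) (hρprim : Primitive ρ)
    (hτaper : ∀ y ∈ Xsub τ, ∀ p : ℕ, 0 < p → shift^[p] y ≠ y)
    (hρaper : ∀ y ∈ Xsub ρ, ∀ p : ℕ, 0 < p → shift^[p] y ≠ y)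
    (lam : ℝ) (hlam : 1 < lam)
    -- `τ` and `ρ`, as dill maps on their subshifts, have balanced growth
    -- with the same growth rate `lam`
    (hτZ : HasZ (Xsub τ) (fun x => τ (x 0)) lam)
    (hρZ : HasZ (Xsub ρ) (fun x => ρ (x 0)) lam)
    (Dτ Dρ : ℝ)
    (hτD : HasDBound (Xsub τ) (fun x => τ (x 0)) lam Dτ)
    (hρD : HasDBound (Xsub ρ) (fun x => ρ (x 0)) lam Dρ)
    -- `ρ⁻¹` is a balanced almost inverse of `ρ`
    (ρinv : (ℕ → B) → (ℕ → B))
    (hρinv : DillMap (Xsub ρ) (Xsub ρ) ρinv)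
    (hinvL : AlmostEquiv (Xsub ρ) (fun x => ρinv (subApply ρ x)) id)
    (hinvR : AlmostEquiv (Xsub ρ) (fun x => subApply ρ (ρinv x)) id)
    (ψ : (ℕ → B) → List B) (hψ : IsImplementation (Xsub ρ) ρinv ψ)
    (μ Dψ : ℝ) (hψZ : HasZ (Xsub ρ) ψ μ) (hψD : HasDBound (Xsub ρ) ψ μ Dψ) :
    ∃ D I : ℕ, ∀ f : (ℕ → A) → (ℕ → B), BlockMap (Xsub τ) (Xsub ρ) f →
      (∀ i : ℕ, ∀ φ : (ℕ → A) → List B,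
        IsImplementation (Xsub τ) (ρinv^[i] ∘ f ∘ (subApply τ)^[i]) φ →
        HasZ (Xsub τ) φ 1 ∧ HasDBound (Xsub τ) φ 1 (D : ℝ)) ∧
      ∃ N : ℕ, ∀ i ≥ N, ∀ φ : (ℕ → A) → List B,
        IsImplementation (Xsub τ) (ρinv^[i] ∘ f ∘ (subApply τ)^[i]) φ →
        HasInRadius (Xsub τ) φ I := by
  classical
  rcases (Xsub τ).eq_empty_or_nonempty with hem | hXne
  · refine ⟨0, 0, fun f _ => ⟨fun i φ _ => ⟨?_, ?_⟩, 0, fun i _ φ _ => ?_⟩⟩ <;>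
    · intro x hx
      rw [hem] at hx
      exact hx.elim
  rcases (Xsub ρ).eq_empty_or_nonempty with hem | hYne
  · refine ⟨0, 0, fun f hf => ?_⟩
    obtain ⟨x, hx⟩ := hXne
    have := hf.1 hx
    rw [hem] at this
    exact this.elim
  have hτ1 := prim_nonerasing hτprim
  have hρ1 := prim_nonerasing hρprim
  have hX := Xsub_shift τ
  have hY := Xsub_shift ρ
  have hXc := Xsub_closed τ
  have hYc := Xsub_closed ρ
  have iτ := subApply_impl hτ1 (Xsub τ)
  have iρ := subApply_impl hρ1 (Xsub ρ)
  have mτ := subApply_maps hτ1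
  have mρ := subApply_maps hρ1
  have mψ := hρinv.1
  set lτ : (ℕ → A) → ℕ := fun x => (τ (x 0)).length with hlτ
  set lρ : (ℕ → B) → ℕ := fun x => (ρ (x 0)).length with hlρ
  set lψ : (ℕ → B) → ℕ := fun x => (ψ x).length with hlψ
  have bτ : ∀ x ∈ Xsub τ, ∀ n : ℕ, |(bsum lτ x n : ℝ) - lam * n| ≤ Dτ := by
    intro x hx n
    have := hτD x hx n
    rwa [iterWord_length] at this
  have bρ : ∀ x ∈ Xsub ρ, ∀ n : ℕ, |(bsum lρ x n : ℝ) - lam * n| ≤ Dρ := by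
    intro x hx n
    have := hρD x hx n
    rwa [iterWord_length] at this
  have bψ : ∀ x ∈ Xsub ρ, ∀ n : ℕ, |(bsum lψ x n : ℝ) - μ * n| ≤ Dψ := by
    intro x hx n
    have := hψD x hx n
    rwa [iterWord_length] at this
  have hDτ : 0 ≤ Dτ := by
    obtain ⟨x, hx⟩ := hXne
    exact (abs_nonneg _).trans (bτ x hx 0)
  have hDψ : 0 ≤ Dψ := by
    obtain ⟨x, hx⟩ := hYne
    exact (abs_nonneg _).trans (bψ x hx 0)
  have hμlam : μ * lam = 1 := by
    refine rate_prod hYc hY hYne hρaper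
      (hρinv.2.1.comp (subApply_cont ρ).continuousOn mρ) hinvL
      (s := fun x n => bsum lψ (subApply ρ x) (bsum lρ x n)) (D := Dψ + |μ| * Dρ) ?_ ?_
    · intro x hx n
      simp only [Function.comp]
      rw [cocycle_iter hY (impl_cocycle iρ) n x hx,
        cocycle_iter hY (impl_cocycle hψ) _ _ (mρ hx)]
    · intro x hx n
      have h1 := bψ _ (mρ hx) (bsum lρ x n)
      have h2 := mul_le_mul_of_nonneg_left (bρ x hx n) (abs_nonneg μ)
      rw [← abs_mul] at h2
      calc _ = |((bsum lψ (subApply ρ x) (bsum lρ x n) : ℝ) - μ * (bsum lρ x n)) +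
            μ * ((bsum lρ x n : ℝ) - lam * n)| := by congr 1; ring
        _ ≤ _ := (abs_add_le _ _).trans (add_le_add h1 h2)
  have hlam0 : 0 < lam := by linarith
  have hμ0 : 0 < μ := by
    by_contra hneg
    nlinarith
  have hμ1 : μ < 1 := by nlinarith
  have hpow : ∀ i : ℕ, μ ^ i * lam ^ i = 1 := fun i => by rw [← mul_pow, hμlam, one_pow]
  obtain ⟨R, hR⟩ := unif_radius hYc hψ.1
  set Eτ : ℝ := Dτ * (1 / (lam - 1)) with hEτ
  have hEτ0 : 0 ≤ Eτ := mul_nonneg hDτ (one_div_nonneg.2 (by linarith))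
  -- bounds for the iterates
  have itτ : ∀ x ∈ Xsub τ, ∀ n i : ℕ,
      |μ ^ i * (itc lτ (subApply τ) x n i : ℝ) - n| ≤ Eτ := by
    intro x hx n i
    have h1 := itc_bound mτ hlam0.le bτ n i x hx
    have h2 := h1.trans (mul_le_mul_of_nonneg_left (geom_bd' hlam i) hDτ)
    have h3 := mul_le_mul_of_nonneg_left h2 (pow_nonneg hμ0.le i)
    rw [← abs_of_nonneg (pow_nonneg hμ0.le i), ← abs_mul,
      abs_of_nonneg (pow_nonneg hμ0.le i)] at h3
    calc _ = |μ ^ i * ((itc lτ (subApply τ) x n i : ℝ) - lam ^ i * n)| := by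
            rw [mul_sub, ← mul_assoc, hpow, one_mul]
      _ ≤ μ ^ i * (Dτ * (lam ^ i * (1 / (lam - 1)))) := h3
      _ = (μ ^ i * lam ^ i) * Eτ := by rw [hEτ]; ring
      _ = Eτ := by rw [hpow, one_mul]
  have itψ : ∀ x ∈ Xsub ρ, ∀ n i : ℕ,
      |(itc lψ ρinv x n i : ℝ) - μ ^ i * n| ≤ Dψ / (1 - μ) := by
    intro x hx n i
    refine (itc_bound mψ hμ0.le bψ n i x hx).trans ?_
    rw [← mul_one_div]
    exact mul_le_mul_of_nonneg_left (geom_bd hμ0.le hμ1 i) hDψ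
  set G : ℝ := (R + Dψ) / (1 - μ) + Dψ / (1 - μ) + R with hGdef
  obtain ⟨D, hDbig⟩ := exists_nat_ge (Dψ / (1 - μ) + Eτ)
  obtain ⟨I, hIbig⟩ := exists_nat_ge (G + 1 + 2 * Eτ)
  refine ⟨D, I, fun f hf => ?_⟩
  -- the cocycle of the conjugated map
  have hlen : ∀ i : ℕ, ∀ φ : (ℕ → A) → List B,
      IsImplementation (Xsub τ) (ρinv^[i] ∘ f ∘ (subApply τ)^[i]) φ → ∀ x ∈ Xsub τ, ∀ n,
      bsum (fun x => (φ x).length) x n =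
        itc lψ ρinv (f ((subApply τ)^[i] x)) (itc lτ (subApply τ) x n i) i := by
    intro i φ hφ x hx n
    have hm : (subApply τ)^[i] x ∈ Xsub τ := mτ.iterate i hx
    have h1 := cocycle_iter hX (impl_cocycle hφ) n x hx
    simp only [Function.comp] at h1
    rw [itc_spec hX mτ (impl_cocycle iτ) n i x hx, block_iter hX hf.2.2 _ _ hm,
      itc_spec hY mψ (impl_cocycle hψ) _ i _ (hf.1 hm)] at h1
    exact (aper_inj hY hρaper (mψ.iterate i (hf.1 hm)) h1).symm
  refine ⟨fun i φ hφ => ?_, ?_⟩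
  · have hDB : HasDBound (Xsub τ) φ 1 (D : ℝ) := by
      intro x hx n
      rw [iterWord_length, hlen i φ hφ x hx n, one_mul]
      have h1 := itψ _ (hf.1 (mτ.iterate i hx)) (itc lτ (subApply τ) x n i) i
      have h2 := itτ x hx n i
      refine le_trans ?_ ((add_le_add h1 h2).trans hDbig)
      exact abs_sub_le _ _ _
    refine ⟨fun x hx => ?_, hDB⟩
    rw [tendsto_iff_norm_sub_tendsto_zero]
    refine squeeze_zero' (Eventually.of_forall fun _ => norm_nonneg _) ?_
      (tendsto_const_div_atTop_nhds_zero_nat (D : ℝ))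
    filter_upwards [eventually_gt_atTop 0] with n hn
    have hn' : (0:ℝ) < n := by exact_mod_cast hn
    have := hDB x hx n
    rw [Real.norm_eq_abs, le_div_iff₀ hn', ← abs_of_pos hn', ← abs_mul, abs_of_pos hn', sub_mul,
      div_mul_cancel₀ _ hn'.ne']
    exact this
  · obtain ⟨r, hr⟩ := block_agree hXc hX hf
    have hlim : Tendsto (fun i : ℕ => μ ^ i * (r : ℝ)) atTop (𝓝 0) := by
      simpa using (tendsto_pow_atTop_nhds_zero_of_lt_one hμ0.le hμ1).mul_const (r : ℝ)
    obtain ⟨N, hN⟩ := eventually_atTop.1 (hlim.eventually (gt_mem_nhds zero_lt_one))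
    refine ⟨N, fun i hi φ hφ x hx y hy hxy => ?_⟩
    have hra := hN i hi
    have hin0 : HasInRadius (Xsub τ) (fun x => τ (x 0)) 0 := fun x _ y _ hk => by
      simp [hk 0 le_rfl]
    have a1 := itc_agree hX mτ iτ hin0 (I + 1) i x y hx hy (fun k hk => hxy k (by omega))
    have a2 := itc_agree hX mτ iτ hin0 1 i x y hx hy (fun k hk => hxy k (by omega))
    have a3 := hr _ (mτ.iterate i hx) _ (mτ.iterate i hy) _ a1.2
    have hsub : (itc lτ (subApply τ) x (I+1) i : ℝ) - r ≤
        ((itc lτ (subApply τ) x (I+1) i - r : ℕ) : ℝ) := by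
      rw [sub_le_iff_le_add]
      exact_mod_cast (by omega)
    obtain ⟨e, L, haL, hLt, -⟩ := inv_agree hY mψ hψ hR hμ0 hμ1 hDψ bψ _ _
      (hf.1 (mτ.iterate i hx)) (hf.1 (mτ.iterate i hy)) _ (itc lτ (subApply τ) x 1 i) i a3 (by
        have h1 := (abs_le.1 (itτ x hx (I+1) i)).1
        have h2 := (abs_le.1 (itτ x hx 1 i)).2
        have h3 := mul_le_mul_of_nonneg_left hsub (pow_nonneg hμ0.le i)
        rw [mul_sub] at h3 ⊢
        push_cast at h1 h2
        linarith) i le_rfl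
    have l1 : ∀ z, (φ z).length = bsum (fun x => (φ x).length) z 1 := fun z => by simp [bsum]
    have ex := (l1 x).trans (hlen i φ hφ x hx 1)
    have ey := (l1 y).trans (hlen i φ hφ y hy 1)
    refine impl_eq hφ hx hy ?_ ?_
    · rw [ex, ey, e]
      exact congrArg (fun t => itc lψ ρinv (f ((subApply τ)^[i] y)) t i) a2.1
    · rw [ex]
      intro k hk
      exact haL k (hk.trans_le ((Nat.le_add_right _ R).trans hLt))
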